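/- Let n ≥ 1 and Γ > 1. There exists D > 1, depending only on Γ and n, such that for all locally finite positive Borel measures σ, ω on ℝ^n one has N_M(σ,ω) ≈ T + √(A₂(σ,ω)), with implicit constants depending only on Γ and n, where T is the least constant such that ∫_Q M(1_Q σ)² dω ≤ T² σ(Q) for all cubes Q ∈ P^n satisfying both σ(ΓQ) ≤ D σ(Q) and the null-boundary condition (σ+ω)(∂Q) = 0. -/

import Mathlib

open MeasureTheory Set Filter
open scoped ENNReal NNReal

noncomputable section

/-- An axis-parallel half-open cube in `ℝⁿ`, given by its lower corner and (positive)
side length. -/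
structure Cube (n : ℕ) where
  corner : Fin n → ℝ
  side : ℝ
  side_pos : 0 < side

namespace Cube

variable {n : ℕ}

/-- The underlying (half-open) set of the cube. -/
def toSet (Q : Cube n) : Set (Fin n → ℝ) :=
  {x | ∀ i, Q.corner i ≤ x i ∧ x i < Q.corner i + Q.side}

/-- The concentric dilate `ΓQ` of the cube `Q` (same center, side length `Γ·ℓ(Q)`),
as a set. -/
def dilate (Q : Cube n) (Γ : ℝ) : Set (Fin n → ℝ) :=
  {x | ∀ i, Q.corner i - (Γ - 1) * Q.side / 2 ≤ x i ∧
       x i < Q.corner i + Q.side + (Γ - 1) * Q.side / 2}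

/-- Membership in `𝒫ⁿ`: the side length is an integral power of `2`. -/
def memP (Q : Cube n) : Prop := ∃ ℓ : ℤ, Q.side = (2:ℝ) ^ ℓ

end Cube

/-- The translation applied at scale `2^ℓ` in the random dyadic grid determined by `β`:
`Σ_{j : 2^{-j} < 2^ℓ} 2^{-j} β_j`. -/
def gridShift {n : ℕ} (β : ℤ → Fin n → Bool) (ℓ : ℤ) (i : Fin n) : ℝ :=
  ∑' j : ℤ, if (2:ℝ) ^ (-j) < (2:ℝ) ^ ℓ ∧ β j i = true then (2:ℝ) ^ (-j) else 0

/-- Membership in the shifted dyadic grid `𝒟^β`. -/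
def memGrid {n : ℕ} (β : ℤ → Fin n → Bool) (Q : Cube n) : Prop :=
  ∃ (ℓ : ℤ) (k : Fin n → ℤ), Q.side = (2:ℝ) ^ ℓ ∧
    ∀ i, Q.corner i = (2:ℝ) ^ ℓ * (k i : ℝ) + gridShift β ℓ i

/-- The Hardy–Littlewood maximal function of a measure, over cubes in `𝒫ⁿ`. -/
def maximal {n : ℕ} (μ : Measure (Fin n → ℝ)) (x : Fin n → ℝ) : ℝ≥0∞ :=
  ⨆ (Q : Cube n) (_ : Q.memP) (_ : x ∈ Q.toSet), μ Q.toSet / volume Q.toSet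

/-- The dyadic maximal function relative to the grid `𝒟^β`. -/
def dyadicMaximal {n : ℕ} (β : ℤ → Fin n → Bool) (μ : Measure (Fin n → ℝ))
    (x : Fin n → ℝ) : ℝ≥0∞ :=
  ⨆ (Q : Cube n) (_ : memGrid β Q) (_ : x ∈ Q.toSet), μ Q.toSet / volume Q.toSet

/-- The two-weight Muckenhoupt constant `A₂(σ,ω)`. -/
def A2 {n : ℕ} (σ ω : Measure (Fin n → ℝ)) : ℝ≥0∞ :=
  ⨆ (Q : Cube n) (_ : Q.memP), (σ Q.toSet / volume Q.toSet) * (ω Q.toSet / volume Q.toSet)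

/-- The operator norm `𝔑_M(σ,ω)` of the maximal function from `L²(σ)` to `L²(ω)`:
the least `N` with `∫ M(fσ)² dω ≤ N² ∫ f² dσ` for all (nonnegative) `f`. -/
def opNorm {n : ℕ} (σ ω : Measure (Fin n → ℝ)) : ℝ≥0∞ :=
  sInf {N : ℝ≥0∞ | ∀ f : (Fin n → ℝ) → ℝ≥0∞, Measurable f →
    ∫⁻ x, (maximal (σ.withDensity f) x) ^ 2 ∂ω ≤ N ^ 2 * ∫⁻ x, (f x) ^ 2 ∂σ}

/-- The restricted testing constant over `D`-`Γ`-doubling cubes with null boundary: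
the least `T` with `∫_Q M(1_Q σ)² dω ≤ T² σ(Q)` for all `Q ∈ 𝒫ⁿ` satisfying both
`σ(ΓQ) ≤ D σ(Q)` and `(σ+ω)(∂Q) = 0`. -/
def testDNull {n : ℕ} (D Γ : ℝ) (σ ω : Measure (Fin n → ℝ)) : ℝ≥0∞ :=
  sInf {T : ℝ≥0∞ | ∀ Q : Cube n, Q.memP →
    σ (Q.dilate Γ) ≤ ENNReal.ofReal D * σ Q.toSet →
    (σ + ω) (frontier Q.toSet) = 0 →
    ∫⁻ x in Q.toSet, (maximal (σ.restrict Q.toSet) x) ^ 2 ∂ω ≤ T ^ 2 * σ Q.toSet}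

section Nested

variable {X ι : Type*} [MeasurableSpace X]

/-- Packing lemma for a finite family of sets any two of which are nested or disjoint. -/
lemma sum_le_measure_biUnion_of_nested (μ : Measure X) (S : ι → Set X)
    (hS : ∀ i, MeasurableSet (S i))
    (hnest : ∀ i j, S i ⊆ S j ∨ S j ⊆ S i ∨ Disjoint (S i) (S j))
    (c : ι → ℝ≥0∞) (F : Finset ι)
    (hc : ∀ i ∈ F, ∀ G ⊆ F, (∀ j ∈ G, S j ⊆ S i) → ∑ j ∈ G, c j ≤ μ (S i)) :
    ∑ i ∈ F, c i ≤ μ (⋃ i ∈ F, S i) := by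
  classical
  induction F using Finset.strongInduction with
  | H F ih =>
    rcases F.eq_empty_or_nonempty with rfl | hne
    · simp
    obtain ⟨m, hmF, hm⟩ := F.exists_maximalFor S hne
    set G := F.filter (fun j => S j ⊆ S m)
    set H := F.filter (fun j => ¬ S j ⊆ S m)
    have hHF : H ⊂ F := Finset.filter_ssubset.2 ⟨m, hmF, by simp⟩
    have hHsum : ∑ i ∈ H, c i ≤ μ (⋃ i ∈ H, S i) :=
      ih H hHF fun i hi G' hG' h =>
        hc i (hHF.1 hi) G' (hG'.trans hHF.1) h
    have hGsum : ∑ i ∈ G, c i ≤ μ (S m) :=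
      hc m hmF G (Finset.filter_subset _ _) fun j hj => (Finset.mem_filter.1 hj).2
    have hdisj : Disjoint (S m) (⋃ i ∈ H, S i) := by
      simp only [Set.disjoint_iUnion_right]
      intro i hi
      obtain ⟨hiF, him⟩ := Finset.mem_filter.1 hi
      rcases hnest m i with h | h | h
      · exact absurd (hm hiF h) him
      · exact absurd h him
      · exact h
    calc ∑ i ∈ F, c i = ∑ i ∈ G, c i + ∑ i ∈ H, c i :=
          (Finset.sum_filter_add_sum_filter_not F _ c).symm
      _ ≤ μ (S m) + μ (⋃ i ∈ H, S i) := add_le_add hGsum hHsum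
      _ = μ (S m ∪ ⋃ i ∈ H, S i) :=
          (measure_union hdisj (Finset.measurableSet_biUnion _ fun i _ => hS i)).symm
      _ ≤ μ (⋃ i ∈ F, S i) := by
          refine measure_mono (Set.union_subset ?_ ?_)
          · exact Set.subset_biUnion_of_mem (u := S) (Finset.mem_coe.2 hmF)
          · exact Set.biUnion_subset_biUnion_left hHF.1

lemma lintegral_indicator_lt_le (b : ℝ≥0∞) :
    ∫⁻ l in Ioi (0 : ℝ), {l : ℝ | ENNReal.ofReal l < b}.indicator 1 l ≤ b := by
  rw [lintegral_indicator_one (measurableSet_lt ENNReal.measurable_ofReal measurable_const)]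
  rcases eq_or_ne b ⊤ with rfl | hb
  · exact le_top
  · lift b to ℝ≥0 using hb
    rw [Measure.restrict_apply
      (measurableSet_lt ENNReal.measurable_ofReal measurable_const)]
    calc volume ({l : ℝ | ENNReal.ofReal l < b} ∩ Ioi 0) ≤ volume (Ioo (0 : ℝ) b) := by
          refine measure_mono fun l hl => ⟨hl.2, ?_⟩
          exact (ENNReal.ofReal_lt_coe_iff hl.2.le).1 hl.1
      _ = b := by simp

lemma sq_le_lintegral_indicator_lt (a : ℝ≥0∞) :
    a ^ 2 ≤ ∫⁻ l in Ioi (0 : ℝ),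
      {l : ℝ | ENNReal.ofReal l < a}.indicator (fun l => ENNReal.ofReal (2 * l)) l := by
  have key : ∀ r : ℝ≥0, (r : ℝ≥0∞) ≤ a → (r : ℝ≥0∞) ^ 2 ≤ ∫⁻ l in Ioi (0 : ℝ),
      {l : ℝ | ENNReal.ofReal l < a}.indicator (fun l => ENNReal.ofReal (2 * l)) l := by
    intro r hr
    have h1 : ∫⁻ l in Ioo (0 : ℝ) r, ENNReal.ofReal (2 * l) = (r : ℝ≥0∞) ^ 2 := by
      rw [← ofReal_integral_eq_lintegral_ofReal]
      · rw [← integral_Ioc_eq_integral_Ioo, ← intervalIntegral.integral_of_le r.coe_nonneg,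
          intervalIntegral.integral_const_mul, integral_id]
        rw [show (2 : ℝ) * (((r : ℝ) ^ 2 - 0 ^ 2) / 2) = (r : ℝ) ^ 2 by ring,
          ENNReal.ofReal_pow r.coe_nonneg, ENNReal.ofReal_coe_nnreal]
      · exact ((continuous_const.mul continuous_id).integrableOn_Icc).mono_set Ioo_subset_Icc_self
      · filter_upwards [ae_restrict_mem measurableSet_Ioo] with l hl
        exact mul_nonneg zero_le_two hl.1.le
    rw [← h1, ← lintegral_indicator measurableSet_Ioo, ← lintegral_indicator measurableSet_Ioi]
    refine lintegral_mono fun l => ?_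
    by_cases hl : l ∈ Ioo (0 : ℝ) r
    · have h2 : ENNReal.ofReal l < a :=
        ((ENNReal.ofReal_lt_coe_iff hl.1.le).2 hl.2).trans_le hr
      rw [indicator_of_mem hl, indicator_of_mem (show l ∈ Ioi 0 from hl.1),
        indicator_of_mem (show l ∈ {l : ℝ | ENNReal.ofReal l < a} from h2)]
    · rw [indicator_of_notMem hl]; exact zero_le
  rcases eq_or_ne a ⊤ with rfl | ha
  · refine ENNReal.le_of_forall_nnreal_lt fun r _ => ?_
    refine le_trans ?_ (key (r + 1) le_top)
    norm_cast
    nlinarith [r.2, sq_nonneg (r : ℝ), zero_le (a := r)]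
  · lift a to ℝ≥0 using ha
    exact key a le_rfl

/-- Carleson embedding for a finite family of sets any two of which are nested or disjoint. -/
lemma sum_mul_sq_le_of_carleson (σ : Measure X) [SFinite σ] (S : ι → Set X)
    (hS : ∀ i, MeasurableSet (S i))
    (hnest : ∀ i j, S i ⊆ S j ∨ S j ⊆ S i ∨ Disjoint (S i) (S j))
    (hfin : ∀ i, σ (S i) ≠ ⊤) (c a : ι → ℝ≥0∞) (A : ℝ≥0∞) (F : Finset ι)
    (hc : ∀ i ∈ F, ∀ G ⊆ F, (∀ j ∈ G, S j ⊆ S i) → ∑ j ∈ G, c j ≤ A * σ (S i))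
    (f : X → ℝ≥0∞) (hf : Measurable f)
    (ha : ∀ i ∈ F, a i * σ (S i) ≤ ∫⁻ x in S i, f x ∂σ) :
    ∑ i ∈ F, c i * a i ^ 2 ≤ 8 * A * ∫⁻ x, f x ^ 2 ∂σ := by
  classical
  set U : ℝ → Set X := fun l => {x | ENNReal.ofReal l < 2 * f x} with hU
  have hUm : ∀ l, MeasurableSet (U l) := fun l =>
    measurableSet_lt measurable_const (hf.const_mul 2)
  have weak : ∀ l : ℝ, 0 < l →
      ∑ i ∈ F, c i * {l : ℝ | ENNReal.ofReal l < a i}.indicator (fun l => ENNReal.ofReal (2 * l)) l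
        ≤ 4 * A * ∫⁻ x, (U l).indicator f x ∂σ := by
    intro l hl
    set L := ENNReal.ofReal l with hL
    have hLt : L ≠ ⊤ := ENNReal.ofReal_ne_top
    set g : X → ℝ≥0∞ := (U l).indicator f with hg
    have hgm : Measurable g := hf.indicator (hUm l)
    set F' := F.filter (fun i => L < a i) with hF'
    have hlow : ∀ i ∈ F', L / 2 * σ (S i) ≤ ∫⁻ x in S i, g x ∂σ := by
      intro i hi
      obtain ⟨hiF, hia⟩ := Finset.mem_filter.1 hi
      have h1 : L / 2 * σ (S i) + L / 2 * σ (S i) ≤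
          ∫⁻ x in S i, g x ∂σ + L / 2 * σ (S i) := by
        calc L / 2 * σ (S i) + L / 2 * σ (S i) = L * σ (S i) := by
              rw [← add_mul, ENNReal.add_halves]
          _ ≤ a i * σ (S i) := by gcongr
          _ ≤ ∫⁻ x in S i, f x ∂σ := ha i hiF
          _ ≤ ∫⁻ x in S i, (g x + L / 2) ∂σ := by
              refine lintegral_mono fun x => ?_
              by_cases hx : x ∈ U l
              · simp [hg, indicator_of_mem hx]
              · have : 2 * f x ≤ L := not_lt.1 hx
                refine le_trans ?_ le_add_self
                rw [ENNReal.le_div_iff_mul_le (by simp) (by simp), mul_comm]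
                exact this
          _ = ∫⁻ x in S i, g x ∂σ + L / 2 * σ (S i) := by
              rw [lintegral_add_left hgm, setLIntegral_const]
      exact (ENNReal.add_le_add_iff_right
        (ENNReal.mul_ne_top (ENNReal.div_ne_top hLt (by simp)) (hfin i))).1 h1
    have hpack : ∑ i ∈ F', L / 2 * c i ≤ A * ∫⁻ x, g x ∂σ := by
      have := sum_le_measure_biUnion_of_nested (A • σ.withDensity g) S hS hnest
        (fun i => L / 2 * c i) F' ?_
      · refine this.trans ?_
        rw [Measure.smul_apply, smul_eq_mul]
        gcongr
        refine (measure_mono (subset_univ _)).trans_eq ?_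
        rw [withDensity_apply _ MeasurableSet.univ, Measure.restrict_univ]
      · intro i hi G hG h
        rw [← Finset.mul_sum, Measure.smul_apply, smul_eq_mul, withDensity_apply _ (hS i)]
        calc L / 2 * ∑ j ∈ G, c j ≤ L / 2 * (A * σ (S i)) := by
              gcongr
              exact hc i (Finset.mem_filter.1 hi).1 G
                (hG.trans (Finset.filter_subset _ _)) h
          _ = A * (L / 2 * σ (S i)) := by ring
          _ ≤ _ := by gcongr; exact hlow i hi
    calc ∑ i ∈ F, c i * {l : ℝ | ENNReal.ofReal l < a i}.indicator
            (fun l => ENNReal.ofReal (2 * l)) l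
        = ∑ i ∈ F', 4 * (L / 2 * c i) := by
          rw [hF', Finset.sum_filter]
          refine Finset.sum_congr rfl fun i _ => ?_
          by_cases h : L < a i
          · rw [if_pos h, indicator_of_mem (show l ∈ {l : ℝ | ENNReal.ofReal l < a i} from h),
              ENNReal.ofReal_mul zero_le_two, ← hL, ENNReal.ofReal_ofNat]
            have : 4 * (L / 2) = 2 * L := by
              rw [show (4 : ℝ≥0∞) = 2 * 2 by norm_num, mul_assoc,
                ENNReal.mul_div_cancel (by simp) (by simp)]
            rw [← mul_assoc 4, this, mul_comm]
          · rw [if_neg h, indicator_of_notMem (show l ∉ {l : ℝ | ENNReal.ofReal l < a i} from h),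
              mul_zero]
      _ = 4 * ∑ i ∈ F', L / 2 * c i := by rw [Finset.mul_sum]
      _ ≤ 4 * (A * ∫⁻ x, g x ∂σ) := by gcongr
      _ = _ := by rw [mul_assoc]
  have hIm : ∀ b : ℝ≥0∞, MeasurableSet {l : ℝ | ENNReal.ofReal l < b} := fun b =>
    measurableSet_lt ENNReal.measurable_ofReal measurable_const
  have hgmeas : Measurable (fun p : ℝ × X => (U p.1).indicator f p.2) := by
    have : (fun p : ℝ × X => (U p.1).indicator f p.2) =
        {p : ℝ × X | ENNReal.ofReal p.1 < 2 * f p.2}.indicator (fun p => f p.2) := by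
      ext p; simp [indicator, hU]
    rw [this]
    exact (hf.comp measurable_snd).indicator (measurableSet_lt
      (ENNReal.measurable_ofReal.comp measurable_fst) ((hf.comp measurable_snd).const_mul 2))
  calc ∑ i ∈ F, c i * a i ^ 2
      ≤ ∑ i ∈ F, c i * ∫⁻ l in Ioi (0 : ℝ),
        {l : ℝ | ENNReal.ofReal l < a i}.indicator (fun l => ENNReal.ofReal (2 * l)) l := by
        gcongr
        exact sq_le_lintegral_indicator_lt _
    _ = ∫⁻ l in Ioi (0 : ℝ), ∑ i ∈ F, c i *
        {l : ℝ | ENNReal.ofReal l < a i}.indicator (fun l => ENNReal.ofReal (2 * l)) l := by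
        have hm : ∀ i, Measurable ({l : ℝ | ENNReal.ofReal l < a i}.indicator
            (fun l => ENNReal.ofReal (2 * l))) := fun i =>
          (ENNReal.measurable_ofReal.comp (measurable_const_mul 2)).indicator (hIm _)
        rw [lintegral_finsetSum _ fun i _ => (hm i).const_mul _]
        exact Finset.sum_congr rfl fun i _ => (lintegral_const_mul _ (hm i)).symm
    _ ≤ ∫⁻ l in Ioi (0 : ℝ), 4 * A * ∫⁻ x, (U l).indicator f x ∂σ :=
        setLIntegral_mono' measurableSet_Ioi fun l hl => weak l hl
    _ = 4 * A * ∫⁻ x, (∫⁻ l in Ioi (0 : ℝ), (U l).indicator f x) ∂σ := by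
        rw [lintegral_const_mul _ hgmeas.lintegral_prod_right',
          lintegral_lintegral_swap hgmeas.aemeasurable]
    _ ≤ 4 * A * ∫⁻ x, 2 * f x ^ 2 ∂σ := by
        gcongr with x
        calc ∫⁻ l in Ioi (0 : ℝ), (U l).indicator f x
            = ∫⁻ l in Ioi (0 : ℝ), f x *
              {l : ℝ | ENNReal.ofReal l < 2 * f x}.indicator 1 l := by
              refine lintegral_congr fun l => ?_
              by_cases h : ENNReal.ofReal l < 2 * f x <;> simp [indicator, hU, h]
          _ = f x * ∫⁻ l in Ioi (0 : ℝ),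
              {l : ℝ | ENNReal.ofReal l < 2 * f x}.indicator 1 l :=
              lintegral_const_mul _ (measurable_one.indicator (hIm _))
          _ ≤ f x * (2 * f x) := by gcongr; exact lintegral_indicator_lt_le _
          _ = 2 * f x ^ 2 := by ring
    _ = 8 * A * ∫⁻ x, f x ^ 2 ∂σ := by
        rw [lintegral_const_mul _ (hf.pow_const 2), ← mul_assoc]
        congr 1; ring

/-- Linearization of a finite maximal function. -/
lemma exists_disjoint_linearization (S : ι → Set X) (hS : ∀ i, MeasurableSet (S i))
    (g : ι → ℝ≥0∞) (F : Finset ι) :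
    ∃ E : ι → Set X, (∀ i, MeasurableSet (E i)) ∧ (∀ i, E i ⊆ S i) ∧
      (F : Set ι).PairwiseDisjoint E ∧
      ∀ x, ⨆ i ∈ F, (S i).indicator (fun _ => g i) x ≤
        ∑ i ∈ F, (E i).indicator (fun _ => g i) x := by
  classical
  induction F using Finset.induction_on_max_value g with
  | empty => exact ⟨fun _ => ∅, by simp, by simp, by simp, by simp⟩
  | insert m F hm hmax ih =>
    obtain ⟨E, hEm, hES, hEd, hE⟩ := ih
    have hne : ∀ i ∈ F, i ≠ m := fun i hi h => hm (h ▸ hi)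
    refine ⟨fun i => if i = m then S m else E i \ S m, fun i => ?_, fun i => ?_, ?_, fun x => ?_⟩
    · dsimp only
      split_ifs
      exacts [hS m, (hEm i).diff (hS m)]
    · dsimp only
      split_ifs with h
      exacts [h ▸ subset_rfl, sdiff_subset.trans (hES i)]
    · rw [Finset.coe_insert, Set.pairwiseDisjoint_insert]
      refine ⟨fun i hi j hj hij => ?_, fun j hj _ => ?_⟩
      · simp only [Function.onFun, if_neg (hne i hi), if_neg (hne j hj)]
        exact (hEd hi hj hij).mono sdiff_subset sdiff_subset
      · simp only [if_neg (hne j hj), if_true]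
        exact disjoint_sdiff_right
    · rw [Finset.sum_insert hm]
      by_cases hx : x ∈ S m
      · refine le_trans (iSup₂_le fun i hi => ?_) le_self_add
        simp only [if_true, indicator_of_mem hx]
        refine (indicator_le_self _ _ _).trans ?_
        rcases Finset.mem_insert.1 hi with rfl | hi
        exacts [le_rfl, hmax i hi]
      · refine le_trans (iSup₂_le fun i hi => ?_) le_add_self
        rcases Finset.mem_insert.1 hi with rfl | hi
        · rw [indicator_of_notMem hx]; exact zero_le
        · refine ((le_iSup₂ (f := fun i (_ : i ∈ F) => (S i).indicator (fun _ => g i) x) i hi).trans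
            (hE x)).trans (Finset.sum_le_sum fun j hj => ?_)
          simp only [if_neg (hne j hj)]
          by_cases hxj : x ∈ E j
          · rw [indicator_of_mem hxj, indicator_of_mem (show x ∈ E j \ S m from ⟨hxj, hx⟩)]
          · rw [indicator_of_notMem hxj]; exact zero_le

end Nested

namespace Cube

variable {n : ℕ}

lemma toSet_eq_pi (Q : Cube n) :
    Q.toSet = Set.pi univ fun i => Ico (Q.corner i) (Q.corner i + Q.side) := by
  ext x; simp [toSet]

lemma measurableSet_toSet (Q : Cube n) : MeasurableSet Q.toSet := by
  rw [toSet_eq_pi]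
  exact MeasurableSet.univ_pi fun i => measurableSet_Ico

lemma volume_toSet (Q : Cube n) : volume Q.toSet = ENNReal.ofReal Q.side ^ n := by
  rw [toSet_eq_pi, Real.volume_pi_Ico]
  simp

lemma volume_toSet_ne_zero (Q : Cube n) : volume Q.toSet ≠ 0 := by
  rw [volume_toSet]
  exact pow_ne_zero _ (by simpa using Q.side_pos)

lemma volume_toSet_ne_top (Q : Cube n) : volume Q.toSet ≠ ⊤ := by
  rw [volume_toSet]
  exact ENNReal.pow_ne_top ENNReal.ofReal_ne_top

lemma measure_toSet_ne_top (Q : Cube n) (μ : Measure (Fin n → ℝ)) [IsLocallyFiniteMeasure μ] :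
    μ Q.toSet ≠ ⊤ := by
  have hsub : Q.toSet ⊆ Set.pi univ fun i => Icc (Q.corner i) (Q.corner i + Q.side) := by
    rw [toSet_eq_pi]
    exact Set.pi_mono fun i _ => Ico_subset_Icc_self
  exact ((measure_mono hsub).trans_lt
    (isCompact_univ_pi fun i => isCompact_Icc).measure_lt_top).ne

lemma frontier_toSet_subset (Q : Cube n) :
    frontier Q.toSet ⊆ ⋃ i, ({x | x i = Q.corner i} ∪ {x | x i = Q.corner i + Q.side}) := by
  intro x hx
  by_contra hcon
  simp only [mem_iUnion, mem_union, mem_ofPred_eq, not_exists, not_or] at hcon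
  have hcl : x ∈ Set.pi univ fun i => Icc (Q.corner i) (Q.corner i + Q.side) := by
    refine closure_minimal ?_ (isClosed_set_pi fun i _ => isClosed_Icc) hx.1
    rw [toSet_eq_pi]
    exact Set.pi_mono fun i _ => Ico_subset_Icc_self
  refine hx.2 (interior_maximal (t := Set.pi univ fun i => Ioo (Q.corner i) (Q.corner i + Q.side))
    ?_ (isOpen_set_pi finite_univ fun i _ => isOpen_Ioo) ?_)
  · rw [toSet_eq_pi]
    exact Set.pi_mono fun i _ => Ioo_subset_Ico_self
  · intro i hi
    exact ⟨lt_of_le_of_ne (hcl i hi).1 (Ne.symm (hcon i).1), lt_of_le_of_ne (hcl i hi).2 (hcon i).2⟩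

/-- The concentric cube with side length `2 ^ m * ℓ(Q)`. -/
def blowUp (Q : Cube n) (m : ℕ) : Cube n where
  corner i := Q.corner i - (2 ^ m - 1) * Q.side / 2
  side := 2 ^ m * Q.side
  side_pos := mul_pos (pow_pos two_pos m) Q.side_pos

lemma blowUp_zero_toSet (Q : Cube n) : (Q.blowUp 0).toSet = Q.toSet := by
  simp [blowUp, toSet]

lemma memP.blowUp {Q : Cube n} (hQ : Q.memP) (m : ℕ) : (Q.blowUp m).memP := by
  obtain ⟨l, hl⟩ := hQ
  refine ⟨m + l, ?_⟩
  rw [zpow_add₀ two_ne_zero, zpow_natCast, ← hl]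
  rfl

lemma volume_blowUp (Q : Cube n) (m : ℕ) :
    volume (Q.blowUp m).toSet = 2 ^ (m * n) * volume Q.toSet := by
  rw [volume_toSet, volume_toSet, blowUp, ENNReal.ofReal_mul (by positivity), mul_pow, pow_mul,
    ENNReal.ofReal_pow zero_le_two, ENNReal.ofReal_ofNat]

lemma subset_blowUp (Q : Cube n) (m : ℕ) : Q.toSet ⊆ (Q.blowUp m).toSet := by
  intro x hx i
  have h1 : (1 : ℝ) ≤ 2 ^ m := one_le_pow₀ one_le_two
  have h2 := mul_nonneg (sub_nonneg.2 h1) Q.side_pos.le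
  simp only [blowUp]
  constructor <;> nlinarith [(hx i).1, (hx i).2]

lemma dilate_blowUp_subset (Q : Cube n) {Γ : ℝ} {a : ℕ} (ha : Γ ≤ 2 ^ a) (m : ℕ) :
    (Q.blowUp m).dilate Γ ⊆ (Q.blowUp (m + a)).toSet := by
  intro x hx i
  have h1 := mul_le_mul_of_nonneg_left ha (mul_pos (pow_pos two_pos m) Q.side_pos).le
  have hx' := hx i
  simp only [blowUp, pow_add] at hx' ⊢
  constructor <;> nlinarith [hx'.1, hx'.2]

lemma bounds_of_toSet_subset {Q R : Cube n} (h : Q.toSet ⊆ R.toSet) (i : Fin n) :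
    R.corner i ≤ Q.corner i ∧ Q.corner i + Q.side ≤ R.corner i + R.side := by
  have hmem : ∀ t, Q.corner i ≤ t → t < Q.corner i + Q.side →
      R.corner i ≤ t ∧ t < R.corner i + R.side := by
    intro t h1 h2
    have hu : Function.update Q.corner i t ∈ Q.toSet := by
      intro j
      rcases eq_or_ne j i with rfl | hj
      · simpa using ⟨h1, h2⟩
      · simpa [hj] using Q.side_pos
    simpa using h hu i
  refine ⟨(hmem _ le_rfl (by linarith [Q.side_pos])).1, ?_⟩
  by_contra hlt
  have := (hmem (max (R.corner i + R.side) (Q.corner i)) (le_max_right _ _)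
    (max_lt (not_le.1 hlt) (by linarith [Q.side_pos]))).2
  exact absurd this (not_lt.2 (le_max_left _ _))

lemma blowUp_mono {Q R : Cube n} (h : Q.toSet ⊆ R.toSet) (m : ℕ) :
    (Q.blowUp m).toSet ⊆ (R.blowUp m).toSet := by
  intro x hx i
  obtain ⟨h1, h2⟩ := bounds_of_toSet_subset h i
  have hx' := hx i
  have h3 : (1 : ℝ) ≤ 2 ^ m := one_le_pow₀ one_le_two
  have h4 := mul_nonneg (sub_nonneg.2 h3) (show 0 ≤ R.side - Q.side by linarith)
  simp only [blowUp] at hx' ⊢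
  constructor <;> nlinarith [hx'.1, hx'.2]

end Cube

section Grid

variable {n : ℕ}

/-- The sign `(-1) ^ l`. -/
def levelSign (l : ℤ) : ℤ := if Even l then 1 else -1

lemma levelSign_succ (l : ℤ) : levelSign (l + 1) = -levelSign l := by
  by_cases h : Even l <;> simp [levelSign, h]

/-- The cubes of a dyadic grid translated by `s`, and by a third of the side length in the
directions selected by `α`. -/
def gridCube (s : Fin n → ℝ) (α : Fin n → Bool) (p : ℤ × (Fin n → ℤ)) : Cube n where
  corner i := s i + 2 ^ p.1 * (p.2 i + if α i then (levelSign p.1 : ℝ) / 3 else 0)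
  side := 2 ^ p.1
  side_pos := zpow_pos two_pos _

lemma gridCube_memP (s : Fin n → ℝ) (α : Fin n → Bool) (p : ℤ × (Fin n → ℤ)) :
    (gridCube s α p).memP := ⟨p.1, rfl⟩

/-- Every vertex coordinate of a grid is a vertex coordinate at every finer level. -/
lemma exists_grid_refine (b : Bool) (l : ℤ) (d : ℕ) (k : ℤ) :
    ∃ k' : ℤ, (2 : ℝ) ^ (l + d) * (k + if b then (levelSign (l + d) : ℝ) / 3 else 0) =
      2 ^ l * (k' + if b then (levelSign l : ℝ) / 3 else 0) := by
  induction d generalizing k with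
  | zero => exact ⟨k, by simp⟩
  | succ d ih =>
    cases b with
    | false =>
      obtain ⟨k', hk'⟩ := ih (2 * k)
      refine ⟨k', hk' ▸ ?_⟩
      rw [Nat.cast_succ, ← add_assoc, zpow_add_one₀ two_ne_zero]
      push_cast
      ring
    | true =>
      obtain ⟨k', hk'⟩ := ih (2 * k - levelSign (l + d))
      refine ⟨k', hk' ▸ ?_⟩
      rw [Nat.cast_succ, ← add_assoc, zpow_add_one₀ two_ne_zero, levelSign_succ]
      push_cast
      simp only [if_true]
      ring

lemma gridCube_subset_or_disjoint (s : Fin n → ℝ) (α : Fin n → Bool) (p q : ℤ × (Fin n → ℤ))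
    (hpq : p.1 ≤ q.1) :
    (gridCube s α p).toSet ⊆ (gridCube s α q).toSet ∨
      Disjoint (gridCube s α p).toSet (gridCube s α q).toSet := by
  obtain ⟨d, hd⟩ := Int.le.dest hpq
  have hpos : (0 : ℝ) < 2 ^ p.1 := zpow_pos two_pos _
  refine or_iff_not_imp_right.2 fun hdis x hx i => ?_
  obtain ⟨y, hyp, hyq⟩ := Set.not_disjoint_iff.1 hdis
  obtain ⟨u, hu⟩ := exists_grid_refine (α i) p.1 d (q.2 i)
  obtain ⟨v, hv⟩ := exists_grid_refine (α i) p.1 d (q.2 i + 1)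
  have hyp' := hyp i
  have hyq' := hyq i
  have hx' := hx i
  simp only [gridCube] at hyp' hyq' hx' ⊢
  rw [hd] at hu hv
  push_cast at hv
  set e : ℝ := if α i then (levelSign p.1 : ℝ) / 3 else 0
  have h1 : (u : ℝ) < p.2 i + 1 := by
    by_contra h
    have := mul_le_mul_of_nonneg_left (not_lt.1 h) hpos.le
    nlinarith
  have h2 : (p.2 i : ℝ) < v := by
    by_contra h
    have := mul_le_mul_of_nonneg_left (not_lt.1 h) hpos.le
    nlinarith
  have h3 : (u : ℝ) ≤ p.2 i := by exact_mod_cast Int.lt_add_one_iff.1 (by exact_mod_cast h1)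
  have h4 : (p.2 i : ℝ) + 1 ≤ v := by exact_mod_cast Int.add_one_le_iff.2 (by exact_mod_cast h2)
  have h5 := mul_le_mul_of_nonneg_left h3 hpos.le
  have h6 := mul_le_mul_of_nonneg_left h4 hpos.le
  constructor <;> nlinarith

lemma gridCube_nested (s : Fin n → ℝ) (α : Fin n → Bool) (p q : ℤ × (Fin n → ℤ)) :
    (gridCube s α p).toSet ⊆ (gridCube s α q).toSet ∨
      (gridCube s α q).toSet ⊆ (gridCube s α p).toSet ∨
      Disjoint (gridCube s α p).toSet (gridCube s α q).toSet := by
  rcases le_total p.1 q.1 with h | h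
  · rcases gridCube_subset_or_disjoint s α p q h with h | h
    exacts [Or.inl h, Or.inr (Or.inr h)]
  · rcases gridCube_subset_or_disjoint s α q p h with h | h
    exacts [Or.inr (Or.inl h), Or.inr (Or.inr h.symm)]

/-- The one-third trick in one dimension. -/
lemma exists_grid_interval (s q : ℝ) (l : ℤ) :
    ∃ (b : Bool) (k : ℤ),
      s + 2 ^ (l + 2) * (k + if b then (levelSign (l + 2) : ℝ) / 3 else 0) ≤ q ∧
      q + 2 ^ l ≤ s + 2 ^ (l + 2) * (k + if b then (levelSign (l + 2) : ℝ) / 3 else 0)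
        + 2 ^ (l + 2) := by
  have hpos : (0 : ℝ) < 2 ^ l := zpow_pos two_pos _
  have h4 : (2 : ℝ) ^ (l + 2) = 4 * 2 ^ l := by
    rw [zpow_add₀ two_ne_zero]; norm_num; ring
  obtain ⟨e, he, hε⟩ : ∃ e : ℤ, levelSign (l + 2) = e ∧ (e = 1 ∨ e = -1) := by
    refine ⟨_, rfl, ?_⟩
    unfold levelSign
    split_ifs <;> simp
  rw [h4, he]
  set t : ℝ := (q - s) / 2 ^ l with ht
  have hq : q = s + 2 ^ l * t := by rw [ht]; field_simp; ring
  by_contra hcon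
  push Not at hcon
  have c0 := hcon false ⌊t / 4⌋
  have c1 := hcon true ⌊(t - 4 * e / 3) / 4⌋
  have f0 := Int.floor_le (t / 4)
  have g0 := Int.lt_floor_add_one (t / 4)
  have f1 := Int.floor_le ((t - 4 * e / 3) / 4)
  have g1 := Int.lt_floor_add_one ((t - 4 * e / 3) / 4)
  simp only [Bool.false_eq_true, if_false, if_true] at c0 c1
  set k := ⌊t / 4⌋
  set k' := ⌊(t - 4 * e / 3) / 4⌋
  have d0 : 4 * (k : ℝ) + 4 < t + 1 := by
    have := c0 (by rw [hq]; nlinarith)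
    rw [hq] at this
    by_contra h
    nlinarith [mul_le_mul_of_nonneg_left (not_lt.1 h) hpos.le]
  have d1 : 4 * ((k' : ℝ) + e / 3) + 4 < t + 1 := by
    have := c1 (by rw [hq]; nlinarith)
    rw [hq] at this
    by_contra h
    nlinarith [mul_le_mul_of_nonneg_left (not_lt.1 h) hpos.le]
  have i0 : 12 * (k - k') - 4 * e < 3 := by
    have : (12 * ((k : ℝ) - k') - 4 * e) < 3 := by linarith
    exact_mod_cast this
  have i1 : -3 < 12 * (k - k') - 4 * e := by
    have : (-3 : ℝ) < (12 * ((k : ℝ) - k') - 4 * e) := by linarith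
    exact_mod_cast this
  rcases hε with rfl | rfl <;> omega

lemma exists_gridCube_superset (s : Fin n → ℝ) (Q : Cube n) (hQ : Q.memP) :
    ∃ (α : Fin n → Bool) (p : ℤ × (Fin n → ℤ)), Q.toSet ⊆ (gridCube s α p).toSet ∧
      volume (gridCube s α p).toSet = 4 ^ n * volume Q.toSet := by
  obtain ⟨l, hl⟩ := hQ
  choose α k h1 h2 using fun i => exists_grid_interval (s i) (Q.corner i) l
  refine ⟨α, (l + 2, k), fun x hx i => ?_, ?_⟩
  · have hx' := hx i
    rw [hl] at hx'
    exact ⟨(h1 i).trans hx'.1, hx'.2.trans_le (h2 i)⟩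
  · have h4 : (2 : ℝ) ^ (l + 2) = 4 * 2 ^ l := by
      rw [zpow_add₀ two_ne_zero]; norm_num; ring
    rw [Cube.volume_toSet, Cube.volume_toSet, ← mul_pow, hl]
    simp only [gridCube]
    rw [h4, ENNReal.ofReal_mul (by norm_num), ENNReal.ofReal_ofNat]

lemma exists_rat_corner_blowUp (s : Fin n → ℝ) (α : Fin n → Bool) (p : ℤ × (Fin n → ℤ)) (m : ℕ)
    (i : Fin n) :
    (∃ r : ℚ, ((gridCube s α p).blowUp m).corner i = s i + r) ∧
      ∃ r : ℚ, ((gridCube s α p).blowUp m).corner i + ((gridCube s α p).blowUp m).side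
        = s i + r := by
  constructor
  · refine ⟨2 ^ p.1 * (p.2 i + if α i then (levelSign p.1 : ℚ) / 3 else 0)
      - (2 ^ m - 1) * 2 ^ p.1 / 2, ?_⟩
    simp only [Cube.blowUp, gridCube]
    split_ifs <;> push_cast <;> ring
  · refine ⟨2 ^ p.1 * (p.2 i + if α i then (levelSign p.1 : ℚ) / 3 else 0)
      - (2 ^ m - 1) * 2 ^ p.1 / 2 + 2 ^ m * 2 ^ p.1, ?_⟩
    simp only [Cube.blowUp, gridCube]
    split_ifs <;> push_cast <;> ring

/-- A generic translate makes all the boundaries of the grids and of their blow-ups null. -/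
lemma exists_null_shift (μ : Measure (Fin n → ℝ)) [SFinite μ] :
    ∃ s : Fin n → ℝ, ∀ (α : Fin n → Bool) (p : ℤ × (Fin n → ℤ)) (m : ℕ),
      μ (frontier ((gridCube s α p).blowUp m).toSet) = 0 := by
  have hex : ∀ i : Fin n, ∃ t : ℝ, ∀ r : ℚ, μ {x | x i = t + r} = 0 := by
    intro i
    have hcount : {t : ℝ | 0 < μ {x : Fin n → ℝ | x i = t}}.Countable := by
      refine Measure.countable_meas_pos_of_disjoint_iUnion
        (fun t => measurableSet_eq_fun (measurable_pi_apply i) measurable_const) ?_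
      intro t u htu
      exact Set.disjoint_left.2 fun x hx hx' => htu (hx.symm.trans hx')
    have hbad : (⋃ r : ℚ, (fun t : ℝ => t - r) ''
        {t : ℝ | 0 < μ {x : Fin n → ℝ | x i = t}}).Countable :=
      countable_iUnion fun r => hcount.image _
    obtain ⟨t, ht⟩ := (hbad.dense_compl ℝ).nonempty
    refine ⟨t, fun r => ?_⟩
    by_contra h
    exact ht (mem_iUnion.2 ⟨r, t + r, pos_iff_ne_zero.2 h, by ring⟩)
  choose s hs using hex
  refine ⟨s, fun α p m => measure_mono_null (Cube.frontier_toSet_subset _) ?_⟩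
  refine measure_iUnion_null fun i => measure_union_null ?_ ?_
  · obtain ⟨r, hr⟩ := (exists_rat_corner_blowUp s α p m i).1
    rw [hr]
    exact hs i r
  · obtain ⟨r, hr⟩ := (exists_rat_corner_blowUp s α p m i).2
    rw [hr]
    exact hs i r

end Grid

section Testing

variable {n : ℕ}

/-- The doubling constant attached to dilations by `2 ^ a` in dimension `n`. -/
def doublingConst (a n : ℕ) : ℝ := 2 * (2 ^ (a * n)) ^ 2

lemma ofReal_doublingConst (a n : ℕ) :
    ENNReal.ofReal (doublingConst a n) = 2 * (2 ^ (a * n)) ^ 2 := by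
  rw [doublingConst, ENNReal.ofReal_mul zero_le_two, ENNReal.ofReal_pow (by positivity),
    ENNReal.ofReal_pow zero_le_two, ENNReal.ofReal_ofNat]

lemma ofReal_doublingConst_pow (a n k : ℕ) :
    ENNReal.ofReal (doublingConst a n) ^ k = 2 ^ k * (2 ^ (a * k * n)) ^ 2 := by
  rw [ofReal_doublingConst, mul_pow, ← pow_mul, ← pow_mul, ← pow_mul]
  congr 2; ring

lemma exists_two_pow_near {u v : ℝ≥0∞} (hu : u ≠ 0) (hv : v ≠ ⊤) (huv : u ≤ v) :
    ∃ j : ℕ, 2 ^ j * u ≤ v ∧ v ≤ 2 ^ (j + 1) * u := by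
  have hex : ∃ m : ℕ, v < 2 ^ m * u := by
    obtain ⟨m, hm⟩ := ENNReal.exists_nat_mul_gt hu hv
    refine ⟨m, hm.trans_le ?_⟩
    gcongr
    exact_mod_cast Nat.lt_two_pow_self.le
  classical
  obtain ⟨j, hj⟩ : ∃ j, Nat.find hex = j + 1 := by
    refine Nat.exists_eq_succ_of_ne_zero fun h0 => ?_
    have := Nat.find_spec hex
    rw [h0, pow_zero, one_mul] at this
    exact absurd huv (not_le.2 this)
  refine ⟨j, not_lt.1 (Nat.find_min hex (by omega)), ?_⟩
  rw [← hj]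
  exact (Nat.find_spec hex).le

/-- Under a finite `A₂` condition, some blow-up of a cube charged by both measures is doubling. -/
lemma exists_doubling_blowUp {Γ : ℝ} {a : ℕ} (ha : Γ ≤ 2 ^ a) (σ ω : Measure (Fin n → ℝ))
    (hA : A2 σ ω ≠ ⊤) (Q : Cube n) (hQ : Q.memP) (hσ : σ Q.toSet ≠ 0) (hω : ω Q.toSet ≠ 0) :
    ∃ k : ℕ, σ ((Q.blowUp (a * k)).dilate Γ) ≤
        ENNReal.ofReal (doublingConst a n) * σ (Q.blowUp (a * k)).toSet ∧
      ENNReal.ofReal (doublingConst a n) ^ k * σ Q.toSet ≤ σ (Q.blowUp (a * k)).toSet := by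
  by_contra! hcon
  set D := ENNReal.ofReal (doublingConst a n) with hD
  have hgrow : ∀ k : ℕ, D ^ k * σ Q.toSet ≤ σ (Q.blowUp (a * k)).toSet := by
    intro k
    induction k with
    | zero => simp [Cube.blowUp_zero_toSet]
    | succ k ih =>
      have hlt : D * σ (Q.blowUp (a * k)).toSet < σ ((Q.blowUp (a * k)).dilate Γ) := by
        by_contra h
        exact absurd ih (not_le.2 (hcon k (not_lt.1 h)))
      calc D ^ (k + 1) * σ Q.toSet = D * (D ^ k * σ Q.toSet) := by ring
        _ ≤ D * σ (Q.blowUp (a * k)).toSet := by gcongr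
        _ ≤ σ ((Q.blowUp (a * k)).dilate Γ) := hlt.le
        _ ≤ σ (Q.blowUp (a * (k + 1))).toSet := measure_mono (Q.dilate_blowUp_subset ha _)
  have hbound : ∀ k : ℕ, 2 ^ k * (σ Q.toSet * ω Q.toSet) ≤ A2 σ ω * volume Q.toSet ^ 2 := by
    intro k
    set R := Q.blowUp (a * k) with hR
    set V : ℝ≥0∞ := (2 ^ (a * k * n)) ^ 2
    have hV0 : V ≠ 0 := by positivity
    have hVt : V ≠ ⊤ := ENNReal.pow_ne_top (ENNReal.pow_ne_top (by simp))
    have h1 : σ R.toSet * ω R.toSet ≤ A2 σ ω * volume R.toSet ^ 2 := by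
      have h2 : σ R.toSet / volume R.toSet * (ω R.toSet / volume R.toSet) ≤ A2 σ ω :=
        le_iSup₂ (f := fun (Q : Cube n) (_ : Q.memP) =>
          σ Q.toSet / volume Q.toSet * (ω Q.toSet / volume Q.toSet)) R (hQ.blowUp _)
      calc σ R.toSet * ω R.toSet
          = σ R.toSet / volume R.toSet * volume R.toSet *
            (ω R.toSet / volume R.toSet * volume R.toSet) := by
            rw [ENNReal.div_mul_cancel R.volume_toSet_ne_zero R.volume_toSet_ne_top,
              ENNReal.div_mul_cancel R.volume_toSet_ne_zero R.volume_toSet_ne_top]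
        _ = σ R.toSet / volume R.toSet * (ω R.toSet / volume R.toSet) * volume R.toSet ^ 2 := by
            ring
        _ ≤ _ := by gcongr
    refine (ENNReal.mul_le_mul_iff_right hV0 hVt).1 ?_
    calc V * (2 ^ k * (σ Q.toSet * ω Q.toSet)) = D ^ k * σ Q.toSet * ω Q.toSet := by
          rw [hD, ofReal_doublingConst_pow]; ring
      _ ≤ σ R.toSet * ω R.toSet :=
          mul_le_mul' (hgrow k) (measure_mono (Q.subset_blowUp _))
      _ ≤ A2 σ ω * volume R.toSet ^ 2 := h1
      _ = V * (A2 σ ω * volume Q.toSet ^ 2) := by rw [hR, Q.volume_blowUp]; ring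
  obtain ⟨m, hm⟩ := ENNReal.exists_nat_mul_gt (mul_ne_zero hσ hω)
    (ENNReal.mul_ne_top hA (ENNReal.pow_ne_top (n := 2) Q.volume_toSet_ne_top))
  refine absurd (hbound m) (not_le.2 (hm.trans_le ?_))
  gcongr
  exact_mod_cast Nat.lt_two_pow_self.le

/-- The testing inequality with constant `T` on doubling cubes with null boundary. -/
def NullTesting (D Γ : ℝ) (σ ω : Measure (Fin n → ℝ)) (T : ℝ≥0∞) : Prop :=
  ∀ Q : Cube n, Q.memP →
    σ (Q.dilate Γ) ≤ ENNReal.ofReal D * σ Q.toSet →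
    (σ + ω) (frontier Q.toSet) = 0 →
    ∫⁻ x in Q.toSet, (maximal (σ.restrict Q.toSet) x) ^ 2 ∂ω ≤ T ^ 2 * σ Q.toSet

/-- Carleson packing for cubes with comparable doubling blow-ups. -/
lemma sum_le_of_nullTesting {Γ : ℝ} {a : ℕ} (σ ω : Measure (Fin n → ℝ))
    {T : ℝ≥0∞} (hT : NullTesting (doublingConst a n) Γ σ ω T) (k j : ℕ)
    {ι : Type*} (Q : ι → Cube n) (hP : ∀ i, (Q i).memP)
    (hnull : ∀ i m, (σ + ω) (frontier ((Q i).blowUp m).toSet) = 0)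
    (E : ι → Set (Fin n → ℝ)) (hE : ∀ i, MeasurableSet (E i)) (hEQ : ∀ i, E i ⊆ (Q i).toSet)
    (G : Finset ι) (hEd : (G : Set ι).PairwiseDisjoint E)
    (hlow : ∀ i ∈ G, 2 ^ j * (ENNReal.ofReal (doublingConst a n) ^ k * σ (Q i).toSet) ≤
      σ ((Q i).blowUp (a * k)).toSet)
    (i₀ : ι) (hsub : ∀ i ∈ G, (Q i).toSet ⊆ (Q i₀).toSet)
    (hdoub : σ (((Q i₀).blowUp (a * k)).dilate Γ) ≤
      ENNReal.ofReal (doublingConst a n) * σ ((Q i₀).blowUp (a * k)).toSet)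
    (hupp : σ ((Q i₀).blowUp (a * k)).toSet ≤
      2 ^ (j + 1) * (ENNReal.ofReal (doublingConst a n) ^ k * σ (Q i₀).toSet)) :
    ∑ i ∈ G, ω (E i) * (σ (Q i).toSet / volume (Q i).toSet) ^ 2 ≤
      2 * T ^ 2 * (2⁻¹ ^ k * 2⁻¹ ^ j) * σ (Q i₀).toSet := by
  set R : ι → Cube n := fun i => (Q i).blowUp (a * k) with hR
  set W : ℝ≥0∞ := 2 ^ (a * k * n) with hW
  have hW0 : W ≠ 0 := by positivity
  have hWt : W ≠ ⊤ := ENNReal.pow_ne_top (by simp)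
  set B : ℝ≥0∞ := 2 ^ j * 2 ^ k with hB
  have hB0 : B ≠ 0 := by positivity
  have hBt : B ≠ ⊤ :=
    ENNReal.mul_ne_top (ENNReal.pow_ne_top (by simp)) (ENNReal.pow_ne_top (by simp))
  have hDk : ENNReal.ofReal (doublingConst a n) ^ k = 2 ^ k * W ^ 2 :=
    ofReal_doublingConst_pow a n k
  have havg : ∀ i ∈ G, B * W * (σ (Q i).toSet / volume (Q i).toSet) ≤
      σ (R i).toSet / volume (R i).toSet := by
    intro i hi
    rw [ENNReal.le_div_iff_mul_le (Or.inl (R i).volume_toSet_ne_zero)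
      (Or.inl (R i).volume_toSet_ne_top), hR, Cube.volume_blowUp, ← hW]
    calc B * W * (σ (Q i).toSet / volume (Q i).toSet) * (W * volume (Q i).toSet)
        = B * W ^ 2 * (σ (Q i).toSet / volume (Q i).toSet * volume (Q i).toSet) := by ring
      _ = 2 ^ j * (ENNReal.ofReal (doublingConst a n) ^ k * σ (Q i).toSet) := by
          rw [ENNReal.div_mul_cancel (Q i).volume_toSet_ne_zero (Q i).volume_toSet_ne_top, hDk, hB]
          ring
      _ ≤ _ := hlow i hi
  have htest : ∑ i ∈ G, ω (E i) * (σ (R i).toSet / volume (R i).toSet) ^ 2 ≤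
      T ^ 2 * σ (R i₀).toSet := by
    calc ∑ i ∈ G, ω (E i) * (σ (R i).toSet / volume (R i).toSet) ^ 2
        ≤ ∑ i ∈ G, ∫⁻ x in E i, (maximal (σ.restrict (R i₀).toSet) x) ^ 2 ∂ω := by
          refine Finset.sum_le_sum fun i hi => ?_
          rw [mul_comm, ← setLIntegral_const]
          refine setLIntegral_mono' (hE i) fun x hx => ?_
          gcongr
          have hRR : (R i).toSet ⊆ (R i₀).toSet := Cube.blowUp_mono (hsub i hi) _
          have hxR : x ∈ (R i).toSet := (Q i).subset_blowUp _ (hEQ i hx)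
          refine le_trans (le_of_eq ?_)
            (le_iSup₂_of_le (R i) ((hP i).blowUp _) (le_iSup_of_le hxR le_rfl))
          rw [Measure.restrict_apply (R i).measurableSet_toSet, inter_eq_self_of_subset_left hRR]
      _ = ∫⁻ x in ⋃ i ∈ G, E i, (maximal (σ.restrict (R i₀).toSet) x) ^ 2 ∂ω :=
          (lintegral_biUnion_finset hEd (fun i _ => hE i) _).symm
      _ ≤ ∫⁻ x in (R i₀).toSet, (maximal (σ.restrict (R i₀).toSet) x) ^ 2 ∂ω := by
          refine lintegral_mono_set (iUnion₂_subset fun i hi => ?_)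
          exact (hEQ i).trans ((hsub i hi).trans ((Q i₀).subset_blowUp _))
      _ ≤ T ^ 2 * σ (R i₀).toSet := hT _ ((hP i₀).blowUp _) hdoub (hnull i₀ _)
  set Z := ∑ i ∈ G, ω (E i) * (σ (Q i).toSet / volume (Q i).toSet) ^ 2 with hZ
  have hmain : B * W ^ 2 * (B * Z) ≤ B * W ^ 2 * (2 * T ^ 2 * σ (Q i₀).toSet) := by
    calc B * W ^ 2 * (B * Z)
        = ∑ i ∈ G, ω (E i) * (B * W * (σ (Q i).toSet / volume (Q i).toSet)) ^ 2 := by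
          rw [hZ, ← mul_assoc, Finset.mul_sum]
          exact Finset.sum_congr rfl fun i _ => by ring
      _ ≤ ∑ i ∈ G, ω (E i) * (σ (R i).toSet / volume (R i).toSet) ^ 2 := by
          refine Finset.sum_le_sum fun i hi => ?_
          gcongr
          exact havg i hi
      _ ≤ T ^ 2 * σ (R i₀).toSet := htest
      _ ≤ T ^ 2 * (2 ^ (j + 1) * (ENNReal.ofReal (doublingConst a n) ^ k * σ (Q i₀).toSet)) := by
          gcongr
      _ = B * W ^ 2 * (2 * T ^ 2 * σ (Q i₀).toSet) := by rw [hDk, hB]; ring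
  have hBZ : B * Z ≤ 2 * T ^ 2 * σ (Q i₀).toSet :=
    (ENNReal.mul_le_mul_iff_right (mul_ne_zero hB0 (pow_ne_zero 2 hW0))
      (ENNReal.mul_ne_top hBt (ENNReal.pow_ne_top hWt))).1 hmain
  have hBinv : (2⁻¹ : ℝ≥0∞) ^ k * 2⁻¹ ^ j = B⁻¹ := by
    rw [hB, ENNReal.mul_inv (Or.inl (by positivity)) (Or.inl (ENNReal.pow_ne_top (by simp))),
      ENNReal.inv_pow, ENNReal.inv_pow, mul_comm]
  rw [hBinv]
  calc Z = B⁻¹ * (B * Z) := by rw [← mul_assoc, ENNReal.inv_mul_cancel hB0 hBt, one_mul]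
    _ ≤ B⁻¹ * (2 * T ^ 2 * σ (Q i₀).toSet) := by gcongr
    _ = _ := by ring

lemma tsum_inv_two_pow_mul : ∑' y : ℕ × ℕ, ((2⁻¹ : ℝ≥0∞) ^ y.1 * 2⁻¹ ^ y.2) = 4 := by
  rw [ENNReal.tsum_prod']
  simp_rw [ENNReal.tsum_mul_left, ENNReal.tsum_geometric_two, ENNReal.tsum_mul_right,
    ENNReal.tsum_geometric_two]
  norm_num

/-- Two-weight bound for the maximal function over a finite nested family of cubes. -/
lemma lintegral_finset_sup_le {Γ : ℝ} {a : ℕ} (ha : Γ ≤ 2 ^ a) (σ ω : Measure (Fin n → ℝ))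
    [IsLocallyFiniteMeasure σ] (hA : A2 σ ω ≠ ⊤)
    {T : ℝ≥0∞} (hT : NullTesting (doublingConst a n) Γ σ ω T)
    {ι : Type*} (Q : ι → Cube n) (hP : ∀ i, (Q i).memP)
    (hnest : ∀ i j, (Q i).toSet ⊆ (Q j).toSet ∨ (Q j).toSet ⊆ (Q i).toSet ∨
      Disjoint (Q i).toSet (Q j).toSet)
    (hnull : ∀ i m, (σ + ω) (frontier ((Q i).blowUp m).toSet) = 0)
    (f : (Fin n → ℝ) → ℝ≥0∞) (hf : Measurable f) (F : Finset ι) :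
    ∫⁻ x, ⨆ i ∈ F, (Q i).toSet.indicator
        (fun _ => ((∫⁻ y in (Q i).toSet, f y ∂σ) / volume (Q i).toSet) ^ 2) x ∂ω ≤
      64 * T ^ 2 * ∫⁻ x, f x ^ 2 ∂σ := by
  classical
  set g : ι → ℝ≥0∞ := fun i => ((∫⁻ y in (Q i).toSet, f y ∂σ) / volume (Q i).toSet) ^ 2 with hg
  set D := ENNReal.ofReal (doublingConst a n) with hD
  obtain ⟨E, hE, hEQ, hEd, hEsup⟩ := exists_disjoint_linearization (fun i => (Q i).toSet)
    (fun i => (Q i).measurableSet_toSet) g F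
  have hD0 : D ≠ 0 := by rw [hD, ofReal_doublingConst]; positivity
  have hsel : ∀ i, ∃ y : ℕ × ℕ, σ (Q i).toSet ≠ 0 → ω (Q i).toSet ≠ 0 →
      σ (((Q i).blowUp (a * y.1)).dilate Γ) ≤ D * σ ((Q i).blowUp (a * y.1)).toSet ∧
      2 ^ y.2 * (D ^ y.1 * σ (Q i).toSet) ≤ σ ((Q i).blowUp (a * y.1)).toSet ∧
      σ ((Q i).blowUp (a * y.1)).toSet ≤ 2 ^ (y.2 + 1) * (D ^ y.1 * σ (Q i).toSet) := by
    intro i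
    by_cases h : σ (Q i).toSet ≠ 0 ∧ ω (Q i).toSet ≠ 0
    · obtain ⟨k, hk1, hk2⟩ := exists_doubling_blowUp ha σ ω hA (Q i) (hP i) h.1 h.2
      obtain ⟨j, hj1, hj2⟩ := exists_two_pow_near (mul_ne_zero (pow_ne_zero k hD0) h.1)
        (Cube.measure_toSet_ne_top _ σ) hk2
      exact ⟨(k, j), fun _ _ => ⟨hk1, hj1, hj2⟩⟩
    · exact ⟨0, fun h1 h2 => absurd ⟨h1, h2⟩ h⟩
  choose y hy using hsel
  set F' := F.filter (fun i => σ (Q i).toSet ≠ 0 ∧ ω (Q i).toSet ≠ 0) with hF'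
  have hgroup : ∀ z : ℕ × ℕ, ∑ i ∈ F' with y i = z, ω (E i) * g i ≤
      8 * (2 * T ^ 2 * (2⁻¹ ^ z.1 * 2⁻¹ ^ z.2)) * ∫⁻ x, f x ^ 2 ∂σ := by
    intro z
    set H := F'.filter (fun i => y i = z) with hH
    have hmem : ∀ i ∈ H, i ∈ F ∧ σ (Q i).toSet ≠ 0 ∧ ω (Q i).toSet ≠ 0 ∧ y i = z := by
      intro i hi
      simpa [hH, hF', and_assoc] using hi
    have hcar := sum_mul_sq_le_of_carleson σ (fun i => (Q i).toSet)
      (fun i => (Q i).measurableSet_toSet) hnest (fun i => (Q i).measure_toSet_ne_top σ)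
      (fun i => ω (E i) * (σ (Q i).toSet / volume (Q i).toSet) ^ 2)
      (fun i => (∫⁻ y in (Q i).toSet, f y ∂σ) / σ (Q i).toSet)
      (2 * T ^ 2 * (2⁻¹ ^ z.1 * 2⁻¹ ^ z.2)) H ?_ f hf ?_
    · refine le_trans (le_of_eq (Finset.sum_congr rfl fun i hi => ?_)) hcar
      obtain ⟨-, h1, -, -⟩ := hmem i hi
      rw [mul_assoc, ← mul_pow]
      simp only [hg]
      congr 2
      rw [div_eq_mul_inv, div_eq_mul_inv, div_eq_mul_inv]
      calc (∫⁻ y in (Q i).toSet, f y ∂σ) * (volume (Q i).toSet)⁻¹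
          = (σ (Q i).toSet * (σ (Q i).toSet)⁻¹) *
            ((∫⁻ y in (Q i).toSet, f y ∂σ) * (volume (Q i).toSet)⁻¹) := by
            rw [ENNReal.mul_inv_cancel h1 ((Q i).measure_toSet_ne_top σ), one_mul]
        _ = _ := by ring
    · intro i hi G hG hsub
      obtain ⟨-, h1, h2, h3⟩ := hmem i hi
      have hyi := hy i h1 h2
      rw [h3] at hyi
      refine sum_le_of_nullTesting σ ω hT z.1 z.2 Q hP hnull E hE hEQ G
        (hEd.subset fun m hm => (hmem m (hG hm)).1) (fun m hm => ?_) i hsub hyi.1 hyi.2.2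
      obtain ⟨-, m1, m2, m3⟩ := hmem m (hG hm)
      have hym := hy m m1 m2
      rw [m3] at hym
      exact hym.2.1
    · intro i hi
      obtain ⟨-, h1, -, -⟩ := hmem i hi
      rw [ENNReal.div_mul_cancel h1 ((Q i).measure_toSet_ne_top σ)]
  calc ∫⁻ x, ⨆ i ∈ F, (Q i).toSet.indicator (fun _ => g i) x ∂ω
      ≤ ∫⁻ x, ∑ i ∈ F, (E i).indicator (fun _ => g i) x ∂ω := lintegral_mono hEsup
    _ = ∑ i ∈ F, ω (E i) * g i := by
        rw [lintegral_finsetSum _ fun i _ => measurable_const.indicator (hE i)]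
        exact Finset.sum_congr rfl fun i _ => by rw [lintegral_indicator_const (hE i), mul_comm]
    _ = ∑ i ∈ F', ω (E i) * g i := by
        refine (Finset.sum_subset (Finset.filter_subset _ _) fun i hi hi' => ?_).symm
        have hor : σ (Q i).toSet = 0 ∨ ω (Q i).toSet = 0 := by
          by_contra h
          exact hi' (Finset.mem_filter.2 ⟨hi, not_or.1 h⟩)
        rcases hor with h | h
        · simp [hg, setLIntegral_measure_zero _ _ h]
        · rw [measure_mono_null (hEQ i) h, zero_mul]
    _ = ∑ z ∈ F'.image y, ∑ i ∈ F' with y i = z, ω (E i) * g i :=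
        (Finset.sum_fiberwise_of_maps_to (fun i hi => Finset.mem_image_of_mem y hi) _).symm
    _ ≤ ∑ z ∈ F'.image y, 8 * (2 * T ^ 2 * (2⁻¹ ^ z.1 * 2⁻¹ ^ z.2)) * ∫⁻ x, f x ^ 2 ∂σ :=
        Finset.sum_le_sum fun z _ => hgroup z
    _ = 16 * T ^ 2 * (∫⁻ x, f x ^ 2 ∂σ) * ∑ z ∈ F'.image y, (2⁻¹ ^ z.1 * 2⁻¹ ^ z.2) := by
        rw [Finset.mul_sum]
        exact Finset.sum_congr rfl fun z _ => by ring
    _ ≤ 16 * T ^ 2 * (∫⁻ x, f x ^ 2 ∂σ) * 4 := by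
        gcongr
        exact (ENNReal.sum_le_tsum _).trans_eq tsum_inv_two_pow_mul
    _ = 64 * T ^ 2 * ∫⁻ x, f x ^ 2 ∂σ := by ring

/-- Two-weight bound for the maximal function over a countable nested family of cubes. -/
lemma lintegral_iSup_cube_le {Γ : ℝ} {a : ℕ} (ha : Γ ≤ 2 ^ a) (σ ω : Measure (Fin n → ℝ))
    [IsLocallyFiniteMeasure σ] (hA : A2 σ ω ≠ ⊤)
    {T : ℝ≥0∞} (hT : NullTesting (doublingConst a n) Γ σ ω T)
    {ι : Type*} [Countable ι] (Q : ι → Cube n) (hP : ∀ i, (Q i).memP)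
    (hnest : ∀ i j, (Q i).toSet ⊆ (Q j).toSet ∨ (Q j).toSet ⊆ (Q i).toSet ∨
      Disjoint (Q i).toSet (Q j).toSet)
    (hnull : ∀ i m, (σ + ω) (frontier ((Q i).blowUp m).toSet) = 0)
    (f : (Fin n → ℝ) → ℝ≥0∞) (hf : Measurable f) :
    ∫⁻ x, ⨆ i, (Q i).toSet.indicator
        (fun _ => ((∫⁻ y in (Q i).toSet, f y ∂σ) / volume (Q i).toSet) ^ 2) x ∂ω ≤
      64 * T ^ 2 * ∫⁻ x, f x ^ 2 ∂σ := by
  classical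
  simp_rw [iSup_eq_iSup_finset fun i => (Q i).toSet.indicator
    (fun _ => ((∫⁻ y in (Q i).toSet, f y ∂σ) / volume (Q i).toSet) ^ 2) _]
  rw [lintegral_iSup_directed_of_measurable]
  · exact iSup_le fun F => lintegral_finset_sup_le ha σ ω hA hT Q hP hnest hnull f hf F
  · intro F
    exact Measurable.biSup _ F.countable_toSet fun i _ =>
      measurable_const.indicator (Q i).measurableSet_toSet
  · intro F G
    refine ⟨F ∪ G, fun x => ?_, fun x => ?_⟩
    · exact biSup_mono fun i hi => Finset.mem_union_left G hi
    · exact biSup_mono fun i hi => Finset.mem_union_right F hi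

/-- The maximal function is controlled by finitely many translated dyadic maximal functions. -/
lemma maximal_sq_le (s : Fin n → ℝ) (μ : Measure (Fin n → ℝ)) (x : Fin n → ℝ) :
    maximal μ x ^ 2 ≤ 16 ^ n * ∑ α : Fin n → Bool, ⨆ p, (gridCube s α p).toSet.indicator
      (fun _ => (μ (gridCube s α p).toSet / volume (gridCube s α p).toSet) ^ 2) x := by
  set B := 16 ^ n * ∑ α : Fin n → Bool, ⨆ p, (gridCube s α p).toSet.indicator
      (fun _ => (μ (gridCube s α p).toSet / volume (gridCube s α p).toSet) ^ 2) x with hB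
  have hmax : maximal μ x ≤ B ^ ((1 : ℝ) / 2) := by
    refine iSup₂_le fun Q hQ => iSup_le fun hx => ?_
    obtain ⟨α, p, hsub, hvol⟩ := exists_gridCube_superset s Q hQ
    set R := gridCube s α p
    have h1 : μ Q.toSet / volume Q.toSet ≤ 4 ^ n * (μ R.toSet / volume R.toSet) := by
      rw [ENNReal.div_le_iff Q.volume_toSet_ne_zero Q.volume_toSet_ne_top]
      calc μ Q.toSet ≤ μ R.toSet := measure_mono hsub
        _ = μ R.toSet / volume R.toSet * volume R.toSet :=
            (ENNReal.div_mul_cancel R.volume_toSet_ne_zero R.volume_toSet_ne_top).symm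
        _ = _ := by rw [hvol]; ring
    have h2 : (μ Q.toSet / volume Q.toSet) ^ 2 ≤ B := by
      calc (μ Q.toSet / volume Q.toSet) ^ 2 ≤ (4 ^ n * (μ R.toSet / volume R.toSet)) ^ 2 := by
            gcongr
        _ = 16 ^ n * (μ R.toSet / volume R.toSet) ^ 2 := by
            rw [mul_pow, ← pow_mul, mul_comm n, pow_mul]; norm_num
        _ ≤ B := by
            rw [hB]
            gcongr
            refine le_trans ?_ (Finset.single_le_sum (fun _ _ => zero_le) (Finset.mem_univ α))
            refine le_iSup_of_le p ?_
            rw [indicator_of_mem (hsub hx)]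
    rw [one_div, ENNReal.le_rpow_inv_iff two_pos]
    exact_mod_cast h2
  calc maximal μ x ^ 2 ≤ (B ^ ((1 : ℝ) / 2)) ^ 2 := by gcongr
    _ = B := by rw [← ENNReal.rpow_natCast, ← ENNReal.rpow_mul]; norm_num

lemma opNorm_le_of_nullTesting {Γ : ℝ} {a : ℕ} (ha : Γ ≤ 2 ^ a) (σ ω : Measure (Fin n → ℝ))
    [IsLocallyFiniteMeasure σ] [IsLocallyFiniteMeasure ω] (hA : A2 σ ω ≠ ⊤)
    {T : ℝ≥0∞} (hT : NullTesting (doublingConst a n) Γ σ ω T) :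
    opNorm σ ω ≤ 8 * 32 ^ n * T := by
  refine sInf_le fun f hf => ?_
  obtain ⟨s, hs⟩ := exists_null_shift (σ + ω)
  calc ∫⁻ x, maximal (σ.withDensity f) x ^ 2 ∂ω
      ≤ ∫⁻ x, 16 ^ n * ∑ α : Fin n → Bool, ⨆ p, (gridCube s α p).toSet.indicator
          (fun _ => ((∫⁻ y in (gridCube s α p).toSet, f y ∂σ) /
            volume (gridCube s α p).toSet) ^ 2) x ∂ω := by
        refine lintegral_mono fun x => (maximal_sq_le s _ x).trans_eq ?_
        simp_rw [withDensity_apply f (Cube.measurableSet_toSet _)]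
    _ = 16 ^ n * ∑ α : Fin n → Bool, ∫⁻ x, ⨆ p, (gridCube s α p).toSet.indicator
          (fun _ => ((∫⁻ y in (gridCube s α p).toSet, f y ∂σ) /
            volume (gridCube s α p).toSet) ^ 2) x ∂ω := by
        have hm : ∀ α : Fin n → Bool, Measurable fun x => ⨆ p, (gridCube s α p).toSet.indicator
            (fun _ => ((∫⁻ y in (gridCube s α p).toSet, f y ∂σ) /
              volume (gridCube s α p).toSet) ^ 2) x := fun α =>
          Measurable.iSup fun p => measurable_const.indicator (Cube.measurableSet_toSet _)
        rw [lintegral_const_mul _ (Finset.measurable_fun_sum _ fun α _ => hm α),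
          lintegral_finsetSum _ fun α _ => hm α]
    _ ≤ 16 ^ n * ∑ _α : Fin n → Bool, 64 * T ^ 2 * ∫⁻ x, f x ^ 2 ∂σ := by
        gcongr with α
        exact lintegral_iSup_cube_le ha σ ω hA hT (gridCube s α) (gridCube_memP s α)
          (gridCube_nested s α) (hs α) f hf
    _ = 64 * 32 ^ n * T ^ 2 * ∫⁻ x, f x ^ 2 ∂σ := by
        rw [Finset.sum_const, Finset.card_univ, Fintype.card_fun, Fintype.card_bool,
          Fintype.card_fin, nsmul_eq_mul, show (32 : ℝ≥0∞) = 16 * 2 by norm_num, mul_pow]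
        push_cast
        ring
    _ ≤ (8 * 32 ^ n * T) ^ 2 * ∫⁻ x, f x ^ 2 ∂σ := by
        gcongr
        have h1 : (1 : ℝ≥0∞) ≤ 32 ^ n := one_le_pow₀ (by norm_num)
        calc 64 * 32 ^ n * T ^ 2 ≤ 64 * (32 ^ n * 32 ^ n) * T ^ 2 := by
              gcongr
              exact le_mul_of_one_le_left zero_le h1
          _ = (8 * 32 ^ n * T) ^ 2 := by ring

lemma lintegral_maximal_restrict_le (σ ω : Measure (Fin n → ℝ)) {N : ℝ≥0∞}
    (hN : ∀ f : (Fin n → ℝ) → ℝ≥0∞, Measurable f →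
      ∫⁻ x, (maximal (σ.withDensity f) x) ^ 2 ∂ω ≤ N ^ 2 * ∫⁻ x, (f x) ^ 2 ∂σ) (Q : Cube n) :
    ∫⁻ x, (maximal (σ.restrict Q.toSet) x) ^ 2 ∂ω ≤ N ^ 2 * σ Q.toSet := by
  have h := hN (Q.toSet.indicator 1) (measurable_one.indicator Q.measurableSet_toSet)
  rw [withDensity_indicator_one Q.measurableSet_toSet] at h
  refine h.trans_eq ?_
  congr 1
  rw [← lintegral_indicator_one Q.measurableSet_toSet]
  refine lintegral_congr fun x => ?_
  by_cases hx : x ∈ Q.toSet <;> simp [hx]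

lemma testDNull_le_opNorm (D Γ : ℝ) (σ ω : Measure (Fin n → ℝ)) :
    testDNull D Γ σ ω ≤ opNorm σ ω := by
  refine le_sInf fun N hN => sInf_le fun Q _ _ _ => ?_
  exact (setLIntegral_le_lintegral _ _).trans (lintegral_maximal_restrict_le σ ω hN Q)

lemma sqrt_A2_le_opNorm (σ ω : Measure (Fin n → ℝ)) [IsLocallyFiniteMeasure σ] :
    A2 σ ω ^ ((1 : ℝ) / 2) ≤ opNorm σ ω := by
  refine le_sInf fun N hN => ?_
  rw [one_div, ENNReal.rpow_inv_le_iff two_pos]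
  refine iSup₂_le fun Q hQ => ?_
  rw [show N ^ (2 : ℝ) = N ^ 2 from ENNReal.rpow_ofNat N 2]
  rcases eq_or_ne (σ Q.toSet) 0 with h0 | h0
  · simp [h0]
  have h1 : (σ Q.toSet / volume Q.toSet) ^ 2 * ω Q.toSet ≤ N ^ 2 * σ Q.toSet := by
    refine le_trans ?_ (lintegral_maximal_restrict_le σ ω hN Q)
    rw [← setLIntegral_const]
    refine (setLIntegral_mono' Q.measurableSet_toSet fun x hx => ?_).trans
      (setLIntegral_le_lintegral Q.toSet _)
    gcongr
    refine le_trans (le_of_eq ?_) (le_iSup₂_of_le Q hQ (le_iSup_of_le hx le_rfl))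
    rw [Measure.restrict_apply_self]
  refine (ENNReal.mul_le_mul_iff_right h0 (Q.measure_toSet_ne_top σ)).1 ?_
  calc σ Q.toSet * (σ Q.toSet / volume Q.toSet * (ω Q.toSet / volume Q.toSet))
      = (σ Q.toSet / volume Q.toSet) ^ 2 * ω Q.toSet := by
        simp only [div_eq_mul_inv]; ring
    _ ≤ N ^ 2 * σ Q.toSet := h1
    _ = _ := mul_comm _ _

end Testing

/-- **Restricted testing over doubling cubes with null boundary.**
For every `Γ > 1` there is `D > 1`, depending only on `Γ` and the dimension `n`, such that
`𝔑_M(σ,ω) ≈ T + √A₂(σ,ω)` for all locally finite positive Borel measures `σ, ω` on `ℝⁿ`,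
with implicit constants depending only on `Γ` and `n`, where `T` is the least constant in
the testing inequality over cubes `Q ∈ 𝒫ⁿ` satisfying both `σ(ΓQ) ≤ D σ(Q)` and
`(σ+ω)(∂Q) = 0`. -/
theorem restricted_testing_null_boundary
    {n : ℕ} (hn : 1 ≤ n) (Γ : ℝ) (hΓ : 1 < Γ) :
    ∃ D : ℝ, 1 < D ∧ ∃ C : ℝ≥0∞, 0 < C ∧ C ≠ ⊤ ∧
      ∀ σ ω : Measure (Fin n → ℝ),
        IsLocallyFiniteMeasure σ → IsLocallyFiniteMeasure ω →
        opNorm σ ω ≤ C * (testDNull D Γ σ ω + A2 σ ω ^ ((1:ℝ)/2)) ∧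
        testDNull D Γ σ ω + A2 σ ω ^ ((1:ℝ)/2) ≤ C * opNorm σ ω := by
  obtain ⟨a, ha⟩ := pow_unbounded_of_one_lt Γ one_lt_two
  refine ⟨doublingConst a n, ?_, 8 * 32 ^ n, by positivity,
    ENNReal.mul_ne_top (by simp) (ENNReal.pow_ne_top (by simp)), fun σ ω hσ hω => ⟨?_, ?_⟩⟩
  · have h1 : (1 : ℝ) ≤ (2 ^ (a * n)) ^ 2 := one_le_pow₀ (one_le_pow₀ one_le_two)
    rw [doublingConst]
    linarith
  · have hC0 : (8 * 32 ^ n : ℝ≥0∞) ≠ 0 := by positivity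
    have hCt : (8 * 32 ^ n : ℝ≥0∞) ≠ ⊤ :=
      ENNReal.mul_ne_top (by simp) (ENNReal.pow_ne_top (by simp))
    rcases eq_or_ne (A2 σ ω) ⊤ with hA | hA
    · rw [hA, ENNReal.top_rpow_of_pos (by norm_num), add_top, ENNReal.mul_top hC0]
      exact le_top
    · refine le_trans ?_ (mul_le_mul_right le_self_add _)
      rw [mul_comm, ← ENNReal.div_le_iff hC0 hCt]
      refine le_sInf fun T hT => ?_
      rw [ENNReal.div_le_iff hC0 hCt, mul_comm]
      exact opNorm_le_of_nullTesting ha.le σ ω hA hT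
  · calc testDNull (doublingConst a n) Γ σ ω + A2 σ ω ^ ((1 : ℝ) / 2)
        ≤ opNorm σ ω + opNorm σ ω :=
          add_le_add (testDNull_le_opNorm _ _ σ ω) (sqrt_A2_le_opNorm σ ω)
      _ = 2 * opNorm σ ω := (two_mul _).symm
      _ ≤ 8 * 32 ^ n * opNorm σ ω := by
          gcongr
          have h1 : (1 : ℝ≥0∞) ≤ 32 ^ n := one_le_pow₀ (by norm_num)
          calc (2 : ℝ≥0∞) ≤ 8 * 1 := by norm_num
            _ ≤ 8 * 32 ^ n := by gcongr
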